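/- Let X ⊆ Π be any set of permutations and suppose there is a (classical) martingale d that succeeds on L_π for every π ∈ X. Then there is a permutation martingale D that succeeds on every π ∈ X. -/

import Mathlib

open Filter MeasureTheory

/-- Binary strings. -/
abbrev Str := List Bool

/-- The standard length-lexicographic enumeration `s_0 = λ, s_1 = 0, s_2 = 1, s_3 = 00, …`
of binary strings: `stdEnum n` is the binary representation of `n+1` with the leading 1 removed. -/
def stdEnum (n : ℕ) : Str := ((n + 1).bits.dropLast).reverse

/-- The set Π of length-preserving permutations of `{0,1}*`. -/
structure LPPerm where
  toFun : Str → Str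
  bij : Function.Bijective toFun
  lenPres : ∀ x, (toFun x).length = x.length

/-- `g` is a prefix partial permutation: a finite list of pairwise distinct binary strings
with `|g(s_i)| = |s_i|` for all `i < |g|`. -/
def IsPPP (g : List Str) : Prop :=
  g.Nodup ∧ ∀ i (h : i < g.length), (g.get ⟨i, h⟩).length = (stdEnum i).length

/-- The finite set of binary strings of length `n`. -/
def strsOfLen (n : ℕ) : Finset Str :=
  (Finset.univ : Finset (Fin n → Bool)).image List.ofFn

/-- `free(g)`: strings of length `|s_{|g|}|` that do not occur as entries of `g`. -/
def freeSet (g : List Str) : Finset Str :=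
  (strsOfLen (stdEnum g.length).length).filter (fun x => x ∉ g)

/-- A permutation martingale: nonnegative and satisfying the averaging condition
`d(g) = (1/|free(g)|) · Σ_{x ∈ free(g)} d((g,x))` on prefix partial permutations. -/
def IsPermMartingale (d : List Str → ℝ) : Prop :=
  (∀ g, 0 ≤ d g) ∧
    ∀ g, IsPPP g → d g = (1 / ((freeSet g).card : ℝ)) * ∑ x ∈ freeSet g, d (g ++ [x])

/-- The cylinder measure `μ(g) = (∏_{k<n} 1/(2^k)!) · (2^n − m)!/(2^n)!` where
`2^n − 1 ≤ |g| < 2^{n+1} − 1` (so `n = log2(|g|+1)`) and `m = |g| − (2^n − 1)`. -/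
noncomputable def muPPP (g : List Str) : ℝ :=
  (∏ k ∈ Finset.range (Nat.log2 (g.length + 1)), (1 : ℝ) / (Nat.factorial (2 ^ k))) *
      (Nat.factorial
        (2 ^ Nat.log2 (g.length + 1) - (g.length - (2 ^ Nat.log2 (g.length + 1) - 1)))) /
      (Nat.factorial (2 ^ Nat.log2 (g.length + 1)))

/-- The cylinder of all permutations extending the prefix partial permutation `g`. -/
def cyl (g : List Str) : Set LPPerm :=
  {π | ∀ i (h : i < g.length), π.toFun (stdEnum i) = g.get ⟨i, h⟩}

/-- The σ-algebra `F_Π` generated by the cylinders. -/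
instance : MeasurableSpace LPPerm :=
  MeasurableSpace.generateFrom {S | ∃ g, IsPPP g ∧ S = cyl g}

/-- `π↾N = [π(s_0), …, π(s_{N−1})]`. -/
def LPPerm.restrict (π : LPPerm) (N : ℕ) : List Str :=
  (List.range N).map (fun i => π.toFun (stdEnum i))

/-- `d` succeeds on `π`: `limsup_{N→∞} d(π↾N) = ∞`. -/
def succeedsOn (d : List Str → ℝ) (π : LPPerm) : Prop :=
  ∀ C : ℝ, ∃ᶠ N in atTop, C < d (π.restrict N)

open Classical in
/-- `A↾n`: the length-`n` prefix of the characteristic sequence of the language `A`. -/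
noncomputable def charPrefix (A : Set Str) (n : ℕ) : List Bool :=
  (List.range n).map (fun i => if stdEnum i ∈ A then true else false)

/-- A classical martingale: nonnegative with `d(w) = (d(w0) + d(w1))/2`. -/
def IsMartingale (d : List Bool → ℝ) : Prop :=
  (∀ w, 0 ≤ d w) ∧ ∀ w, d w = (d (w ++ [false]) + d (w ++ [true])) / 2

/-- A classical martingale succeeds on a language `A` if `limsup_{n→∞} d(A↾n) = ∞`. -/
def succeedsOnLang (d : List Bool → ℝ) (A : Set Str) : Prop :=
  ∀ C : ℝ, ∃ᶠ n in atTop, C < d (charPrefix A n)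

/-- The language `L_π = {x : |x| ≥ 1 and the first bit of π(0^{2|x|}x) is 1}`. -/
def Lpi (π : LPPerm) : Set Str :=
  {x | x ≠ [] ∧ (π.toFun (List.replicate (2 * x.length) false ++ x)).head? = some true}

/-- A list of the `n` lowest binary digits of `v`, least significant first. -/
def lowBits (n v : ℕ) : List Bool := (List.range n).map v.testBit

theorem lowBits_succ (n v : ℕ) : lowBits (n + 1) v = v.testBit 0 :: lowBits n (v / 2) := by
  simp only [lowBits, List.range_succ_eq_map, List.map_cons, List.map_map]
  congr 1
  apply List.map_congr_left
  intro i _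
  simp [Nat.testBit_succ]

theorem bits_two_pow_add (n v : ℕ) (hv : v < 2 ^ n) :
    (2 ^ n + v).bits = lowBits n v ++ [true] := by
  induction n generalizing v with
  | zero =>
    obtain rfl : v = 0 := by simpa using hv
    simp [lowBits]
  | succ n ih =>
    rw [lowBits_succ, List.cons_append, ← ih (v / 2) (by rw [pow_succ] at hv; omega)]
    have hpos : 0 < 2 ^ n := by positivity
    rcases Nat.even_or_odd' v with ⟨k, rfl | rfl⟩
    · have : 2 ^ (n + 1) + 2 * k = 2 * (2 ^ n + k) := by ring
      rw [this, Nat.bit0_bits _ (by omega)]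
      simp
    · have : 2 ^ (n + 1) + (2 * k + 1) = 2 * (2 ^ n + k) + 1 := by ring
      rw [this, Nat.bit1_bits]
      have : (2 * k + 1) / 2 = k := by omega
      simp [this]

theorem stdEnum_eq_lowBits (n v i : ℕ) (hv : v < 2 ^ n) (hi : i + 1 = 2 ^ n + v) :
    stdEnum i = (lowBits n v).reverse := by
  simp [stdEnum, hi, bits_two_pow_add n v hv]

theorem exists_eq_two_pow_log2_add (i : ℕ) :
    ∃ v, v < 2 ^ Nat.log2 (i + 1) ∧ i + 1 = 2 ^ Nat.log2 (i + 1) + v := by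
  have h1 := Nat.log2_self_le (n := i + 1) (by omega)
  have h2 := Nat.lt_log2_self (n := i + 1)
  rw [pow_succ] at h2
  exact ⟨i + 1 - 2 ^ Nat.log2 (i + 1), by omega, by omega⟩

theorem length_stdEnum (i : ℕ) : (stdEnum i).length = Nat.log2 (i + 1) := by
  obtain ⟨v, hv, hi⟩ := exists_eq_two_pow_log2_add i
  rw [stdEnum_eq_lowBits _ v i hv hi]
  simp [lowBits]

theorem lowBits_add (n m v : ℕ) (hv : v < 2 ^ n) :
    lowBits (n + m) v = lowBits n v ++ List.replicate m false := by
  simp only [lowBits, List.range_add, List.map_append, List.map_map]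
  congr 1
  rw [List.eq_replicate_iff]
  refine ⟨by simp, ?_⟩
  simp only [List.mem_map, Function.comp]
  rintro b ⟨i, -, rfl⟩
  exact Nat.testBit_lt_two_pow (hv.trans_le (Nat.pow_le_pow_right (by norm_num) (by omega)))

/-- The index of `0^{2|x|}x` in the standard enumeration, where `x = s_j`. -/
def padIndex (j : ℕ) : ℕ := 2 ^ Nat.log2 (j + 1) * (4 ^ Nat.log2 (j + 1) - 1) + j

theorem padIndex_add_one (j v : ℕ) (hj : j + 1 = 2 ^ Nat.log2 (j + 1) + v) :
    padIndex j + 1 = 2 ^ (3 * Nat.log2 (j + 1)) + v := by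
  unfold padIndex
  generalize Nat.log2 (j + 1) = n at *
  obtain ⟨q, hq⟩ := Nat.exists_eq_add_of_le (Nat.one_le_pow n 4 (by norm_num))
  have h8 : 2 ^ (3 * n) = 2 ^ n * 4 ^ n := by
    rw [← mul_pow, pow_mul]; norm_num
  rw [h8, add_assoc, hj, hq, Nat.add_sub_cancel_left]
  ring

theorem padIndex_strictMono : StrictMono padIndex := by
  apply strictMono_nat_of_lt_succ
  intro j
  have hl : Nat.log2 (j + 1) ≤ Nat.log2 (j + 1 + 1) := by
    rw [Nat.log2_eq_log_two, Nat.log2_eq_log_two]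
    exact Nat.log_mono_right (by omega)
  have h2 : 2 ^ Nat.log2 (j + 1) ≤ 2 ^ Nat.log2 (j + 1 + 1) := Nat.pow_le_pow_right (by norm_num) hl
  have h4 : 4 ^ Nat.log2 (j + 1) ≤ 4 ^ Nat.log2 (j + 1 + 1) := Nat.pow_le_pow_right (by norm_num) hl
  have := Nat.mul_le_mul h2 (Nat.sub_le_sub_right h4 1)
  unfold padIndex
  omega

theorem log2_padIndex (j : ℕ) : Nat.log2 (padIndex j + 1) = 3 * Nat.log2 (j + 1) := by
  obtain ⟨v, hv, hj⟩ := exists_eq_two_pow_log2_add j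
  rw [padIndex_add_one j v hj, Nat.log2_eq_iff (by positivity)]
  have : 2 ^ Nat.log2 (j + 1) ≤ 2 ^ (3 * Nat.log2 (j + 1)) :=
    Nat.pow_le_pow_right (by norm_num) (by omega)
  rw [pow_succ]
  omega

theorem stdEnum_padIndex (j : ℕ) :
    stdEnum (padIndex j) = List.replicate (2 * (stdEnum j).length) false ++ stdEnum j := by
  obtain ⟨v, hv, hj⟩ := exists_eq_two_pow_log2_add j
  have hv3 : v < 2 ^ (3 * Nat.log2 (j + 1)) :=
    hv.trans_le (Nat.pow_le_pow_right (by norm_num) (by omega))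
  rw [length_stdEnum, stdEnum_eq_lowBits _ v _ hv3 (padIndex_add_one j v hj),
    stdEnum_eq_lowBits _ v j hv hj,
    show 3 * Nat.log2 (j + 1) = Nat.log2 (j + 1) + 2 * Nat.log2 (j + 1) by ring,
    lowBits_add _ _ _ hv]
  simp

/-- Whether the first bit of `x` is `1`. -/
def firstBit (x : Str) : Bool := decide (x.head? = some true)

theorem mem_strsOfLen (n : ℕ) (x : Str) : x ∈ strsOfLen n ↔ x.length = n := by
  simp only [strsOfLen, Finset.mem_image, Finset.mem_univ, true_and]
  constructor
  · rintro ⟨f, rfl⟩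
    simp
  · rintro rfl
    exact ⟨x.get, List.ofFn_get x⟩

theorem card_strsOfLen (n : ℕ) : (strsOfLen n).card = 2 ^ n := by
  rw [strsOfLen, Finset.card_image_of_injective _ List.ofFn_injective]
  simp

theorem card_filter_firstBit (n : ℕ) (b : Bool) :
    ((strsOfLen (n + 1)).filter (fun x => firstBit x = b)).card = 2 ^ n := by
  have : (strsOfLen (n + 1)).filter (fun x => firstBit x = b) =
      (strsOfLen n).image (List.cons b) := by
    ext x
    simp only [Finset.mem_filter, mem_strsOfLen, Finset.mem_image]
    cases x with
    | nil => simp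
    | cons a t => cases a <;> cases b <;> simp [firstBit]
  rw [this, Finset.card_image_of_injective _ (List.cons_injective), card_strsOfLen]

/-- Entry `i` of the list has the length of `s_i`. -/
def LenCompat (g : List Str) : Prop :=
  ∀ i (h : i < g.length), (g.get ⟨i, h⟩).length = (stdEnum i).length

/-- Only the entries from position `2^n - 1` on, `n = |s_{|g|}|`, have length `n`. -/
theorem card_le_card_filter_notMem (g : List Str) (hg : LenCompat g) (S : Finset Str)
    (hS : S ⊆ strsOfLen (Nat.log2 (g.length + 1))) :
    S.card ≤ (S.filter (fun x => x ∉ g)).card +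
      (g.length - (2 ^ Nat.log2 (g.length + 1) - 1)) := by
  have hsub : S ⊆ S.filter (fun x => x ∉ g) ∪
      (g.drop (2 ^ Nat.log2 (g.length + 1) - 1)).toFinset := by
    intro x hx
    by_cases hxg : x ∈ g
    · refine Finset.mem_union_right _ (List.mem_toFinset.2 ?_)
      obtain ⟨i, hi, rfl⟩ := List.getElem_of_mem hxg
      have h1 := (mem_strsOfLen _ _).1 (hS hx)
      have h2 := hg i hi
      rw [List.get_eq_getElem, h1, length_stdEnum] at h2
      have h3 := Nat.log2_self_le (n := i + 1) (by omega)
      rw [← h2] at h3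
      rw [List.mem_iff_getElem]
      refine ⟨i - (2 ^ Nat.log2 (g.length + 1) - 1), by simp; omega, ?_⟩
      rw [List.getElem_drop]
      congr 1
      omega
    · exact Finset.mem_union_left _ (Finset.mem_filter.2 ⟨hx, hxg⟩)
  calc S.card ≤ _ := Finset.card_le_card hsub
    _ ≤ _ := Finset.card_union_le _ _
    _ ≤ _ := by
      gcongr
      exact (List.toFinset_card_le _).trans (by simp)

theorem two_pow_le_card_freeSet (g : List Str) (hg : LenCompat g) :
    2 ^ Nat.log2 (g.length + 1) ≤ (freeSet g).card +
      (g.length - (2 ^ Nat.log2 (g.length + 1) - 1)) := by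
  have := card_le_card_filter_notMem g hg _ subset_rfl
  rw [card_strsOfLen] at this
  rwa [freeSet, length_stdEnum]

theorem card_freeSet_pos (g : List Str) (hg : LenCompat g) : 0 < (freeSet g).card := by
  have h := two_pow_le_card_freeSet g hg
  have h2 := Nat.lt_log2_self (n := g.length + 1)
  have h1 := Nat.log2_self_le (n := g.length + 1) (by omega)
  rw [pow_succ] at h2
  omega

/-- The number of free strings with first bit `b`. -/
def freeCount (g : List Str) (b : Bool) : ℕ :=
  ((freeSet g).filter (fun x => firstBit x = b)).card

/-- The positions of the strings `0^{2|x|}x` with `|x| ≥ 1`. -/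
def IsPad (i : ℕ) : Prop := ∃ j, 1 ≤ j ∧ padIndex j = i

theorem one_le_log2_succ (j : ℕ) (hj : 1 ≤ j) : 1 ≤ Nat.log2 (j + 1) := by
  rw [Nat.le_log2 (by omega)]
  omega

theorem two_mul_freeCount_le (g : List Str) (b : Bool) (j : ℕ) (hj : 1 ≤ j)
    (hgj : padIndex j = g.length) : 2 * freeCount g b ≤ 2 ^ (3 * Nat.log2 (j + 1)) := by
  have h1 := one_le_log2_succ j hj
  obtain ⟨k, hk⟩ : ∃ k, 3 * Nat.log2 (j + 1) = k + 1 := ⟨3 * Nat.log2 (j + 1) - 1, by omega⟩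
  have hle : freeCount g b ≤ ((strsOfLen (k + 1)).filter (fun x => firstBit x = b)).card := by
    apply Finset.card_le_card
    apply Finset.filter_subset_filter
    rw [← hk, ← log2_padIndex, hgj, ← length_stdEnum]
    exact Finset.filter_subset _ _
  rw [card_filter_firstBit] at hle
  rw [hk, pow_succ]
  omega

theorem freeCount_pos (g : List Str) (hg : LenCompat g) (b : Bool) (hp : IsPad g.length) :
    0 < freeCount g b := by
  obtain ⟨j, hj, hgj⟩ := hp
  have h1 := one_le_log2_succ j hj
  have hlog := log2_padIndex j
  rw [hgj] at hlog
  obtain ⟨v, hv, hjv⟩ := exists_eq_two_pow_log2_add j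
  have hpad := padIndex_add_one j v hjv
  obtain ⟨k, hk⟩ : ∃ k, 3 * Nat.log2 (j + 1) = k + 1 := ⟨3 * Nat.log2 (j + 1) - 1, by omega⟩
  have hle := card_le_card_filter_notMem g hg
    ((strsOfLen (Nat.log2 (g.length + 1))).filter (fun x => firstBit x = b))
    (Finset.filter_subset _ _)
  rw [Finset.filter_comm, hlog, hk, card_filter_firstBit, ← hk, ← hlog, ← length_stdEnum] at hle
  change 2 ^ k ≤ freeCount g b + _ at hle
  rw [length_stdEnum, hlog] at hle
  have hlt : 2 ^ Nat.log2 (j + 1) ≤ 2 ^ k := Nat.pow_le_pow_right (by norm_num) (by omega)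
  omega

open Classical in
/-- The bits of `L_π` determined by a prefix of `π`, which is given in reverse order. -/
noncomputable def revBits : List Str → List Bool
  | [] => [false]
  | x :: t => if IsPad t.length then revBits t ++ [firstBit x] else revBits t

open Classical in
/-- The likelihood ratio between fair coin tosses and the bits of a random permutation
along a prefix, which is given in reverse order. -/
noncomputable def revRatio : List Str → ℝ
  | [] => 1
  | x :: t => if IsPad t.length then
      revRatio t * ((freeSet t.reverse).card / (2 * freeCount t.reverse (firstBit x)))
    else revRatio t

theorem revRatio_nonneg (g : List Str) : 0 ≤ revRatio g := by
  induction g with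
  | nil => simp [revRatio]
  | cons x t ih =>
    rw [revRatio]
    split_ifs
    · positivity
    · exact ih

/-- The permutation martingale that simulates `d`. -/
noncomputable def liftMartingale (d : List Bool → ℝ) (g : List Str) : ℝ :=
  d (revBits g.reverse) * revRatio g.reverse

theorem isPermMartingale_liftMartingale (d : List Bool → ℝ) (hd : IsMartingale d) :
    IsPermMartingale (liftMartingale d) := by
  refine ⟨fun g => mul_nonneg (hd.1 _) (revRatio_nonneg _), fun g hg => ?_⟩
  have hF : ((freeSet g).card : ℝ) ≠ 0 := by
    exact_mod_cast (card_freeSet_pos g hg.2).ne'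
  by_cases hp : IsPad g.length
  · have hc : ∀ b, (freeCount g b : ℝ) ≠ 0 := fun b => by
      exact_mod_cast (freeCount_pos g hg.2 b hp).ne'
    have hsum : ∀ b, ∑ x ∈ (freeSet g).filter (fun x => firstBit x = b),
        liftMartingale d (g ++ [x]) =
        d (revBits g.reverse ++ [b]) * revRatio g.reverse * ((freeSet g).card / 2) := by
      intro b
      have : ∀ x ∈ (freeSet g).filter (fun x => firstBit x = b), liftMartingale d (g ++ [x]) =
          d (revBits g.reverse ++ [b]) *
            (revRatio g.reverse * ((freeSet g).card / (2 * freeCount g b))) := by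
        intro x hx
        have hb := (Finset.mem_filter.1 hx).2
        simp [liftMartingale, revBits, revRatio, hp, hb]
      rw [Finset.sum_congr rfl this, Finset.sum_const, nsmul_eq_mul]
      change (freeCount g b : ℝ) * _ = _
      have := hc b
      field_simp
    rw [← Finset.sum_fiberwise (freeSet g) firstBit, Fintype.sum_bool, hsum, hsum, liftMartingale,
      hd.2 (revBits g.reverse)]
    field_simp
    ring
  · have : ∀ x ∈ freeSet g, liftMartingale d (g ++ [x]) = liftMartingale d g := by
      intro x _
      simp [liftMartingale, revBits, revRatio, hp]
    rw [Finset.sum_congr rfl this, Finset.sum_const, nsmul_eq_mul]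
    field_simp

theorem length_restrict (π : LPPerm) (N : ℕ) : (π.restrict N).length = N := by
  simp [LPPerm.restrict]

theorem lenCompat_restrict (π : LPPerm) (N : ℕ) : LenCompat (π.restrict N) := by
  intro i h
  simp [LPPerm.restrict, π.lenPres]

theorem restrict_succ (π : LPPerm) (N : ℕ) :
    π.restrict (N + 1) = π.restrict N ++ [π.toFun (stdEnum N)] := by
  simp [LPPerm.restrict, List.range_succ]

open Classical in
theorem firstBit_padIndex (π : LPPerm) (j : ℕ) (hj : 1 ≤ j) :
    firstBit (π.toFun (stdEnum (padIndex j))) = decide (stdEnum j ∈ Lpi π) := by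
  have hne : stdEnum j ≠ [] := by
    intro h
    have h1 := one_le_log2_succ j hj
    rw [← length_stdEnum, h] at h1
    simp at h1
  simp [firstBit, Lpi, stdEnum_padIndex, hne]

theorem le_card_freeSet_div (g : List Str) (hg : LenCompat g) (b : Bool) (j : ℕ) (hj : 1 ≤ j)
    (hgj : padIndex j = g.length) :
    (j * (j + 4) / (j + 2) ^ 2 : ℝ) ≤ (freeSet g).card / (2 * freeCount g b) := by
  have hpos := freeCount_pos g hg b ⟨j, hj, hgj⟩
  have hle := two_mul_freeCount_le g b j hj hgj
  have hF := two_pow_le_card_freeSet g hg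
  obtain ⟨v, hv, hjv⟩ := exists_eq_two_pow_log2_add j
  have hpad := padIndex_add_one j v hjv
  rw [← hgj, log2_padIndex] at hF
  have hF' : 2 ^ (3 * Nat.log2 (j + 1)) ≤ (freeSet g).card + 2 ^ Nat.log2 (j + 1) := by omega
  have hjT : j + 2 ≤ 2 * 2 ^ Nat.log2 (j + 1) := by omega
  rw [mul_comm 3, pow_mul] at hF' hle
  generalize 2 ^ Nat.log2 (j + 1) = T at hF' hle hjT
  have hpos' : (0 : ℝ) < freeCount g b := by exact_mod_cast hpos
  have hle' : 2 * (freeCount g b : ℝ) ≤ T ^ 3 := by exact_mod_cast hle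
  have hF'' : (T : ℝ) ^ 3 - T ≤ (freeSet g).card := by
    rw [sub_le_iff_le_add]; exact_mod_cast hF'
  have hjT' : (j + 2 : ℝ) ≤ 2 * T := by exact_mod_cast hjT
  have hT : (0 : ℝ) ≤ T := by positivity
  have hj0 : (0 : ℝ) ≤ j := by positivity
  rw [div_le_div_iff₀ (by positivity) (by positivity)]
  have hsq : ((j : ℝ) + 2) ^ 2 ≤ (2 * T) ^ 2 := by gcongr
  calc (j * (j + 4) : ℝ) * (2 * freeCount g b) ≤ j * (j + 4) * T ^ 3 := by gcongr
    _ ≤ (T ^ 3 - T) * (j + 2) ^ 2 := by nlinarith [mul_le_mul_of_nonneg_left hsq hT]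
    _ ≤ _ := by gcongr

open Classical in
theorem charPrefix_succ (A : Set Str) (n : ℕ) :
    charPrefix A (n + 1) = charPrefix A n ++ [decide (stdEnum n ∈ A)] := by
  simp only [charPrefix, List.range_succ, List.map_append, List.map_cons, List.map_nil]
  simp

/-- The prefix of `π` of length `N` determines the prefix of `L_π` whose length is the number of
padded positions below `N`, and the likelihood ratio obeys a telescoping lower bound. -/
theorem revBits_restrict (π : LPPerm) (N : ℕ) (j : ℕ) (hj : 1 ≤ j)
    (hjN : ∀ k, 1 ≤ k → (padIndex k < N ↔ k < j)) :
    revBits (π.restrict N).reverse = charPrefix (Lpi π) j ∧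
      ((j + 2) * (j + 3) / (6 * j * (j + 1)) : ℝ) ≤ revRatio (π.restrict N).reverse := by
  induction N generalizing j with
  | zero =>
    obtain rfl : j = 1 := by
      have := hjN 1 le_rfl
      omega
    constructor
    · simp [LPPerm.restrict, revBits, charPrefix, Lpi, stdEnum]
    · simp only [LPPerm.restrict, List.range_zero, List.map_nil, List.reverse_nil, revRatio]
      norm_num
  | succ N ih =>
    rw [restrict_succ, List.reverse_append, List.reverse_singleton, List.singleton_append, revBits,
      revRatio, List.length_reverse, length_restrict, List.reverse_reverse]
    by_cases hp : IsPad N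
    · rw [if_pos hp, if_pos hp]
      obtain ⟨m, hm, rfl⟩ := hp
      obtain rfl : j = m + 1 := by
        have h1 := (hjN m hm).1 (by omega)
        have h2 := hjN (m + 1) (by omega)
        have h3 := padIndex_strictMono (show m < m + 1 by omega)
        omega
      obtain ⟨ih1, ih2⟩ := ih m hm (fun k _ => padIndex_strictMono.lt_iff_lt)
      refine ⟨by rw [ih1, charPrefix_succ, firstBit_padIndex π m hm], ?_⟩
      refine le_trans (le_of_eq ?_) (mul_le_mul ih2 (le_card_freeSet_div (π.restrict (padIndex m))
        (lenCompat_restrict π _) _ m hm (length_restrict π _).symm) (by positivity)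
        (revRatio_nonneg _))
      have : (0 : ℝ) < m := by exact_mod_cast hm
      push_cast
      field_simp
      ring
    · rw [if_neg hp, if_neg hp]
      refine ih j hj fun k hk => ?_
      have : padIndex k ≠ N := fun h => hp ⟨k, hk, h⟩
      rw [← hjN k hk]
      omega

/-- if a classical martingale `d` succeeds on `L_π` for every `π ∈ X`,
then there is a permutation martingale `D` succeeding on every `π ∈ X`. -/
theorem stmt12 (X : Set LPPerm) (d : List Bool → ℝ) (hd : IsMartingale d)
    (h : ∀ π ∈ X, succeedsOnLang d (Lpi π)) :
    ∃ D : List Str → ℝ, IsPermMartingale D ∧ ∀ π ∈ X, succeedsOn D π := by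
  refine ⟨liftMartingale d, isPermMartingale_liftMartingale d hd, fun π hπ C => ?_⟩
  rw [frequently_atTop]
  intro a
  obtain ⟨j, hja, hj⟩ := (frequently_atTop.1 (h π hπ (6 * |C|))) (max a 1)
  refine ⟨padIndex j, ?_, ?_⟩
  · exact (le_max_left a 1).trans (hja.trans padIndex_strictMono.le_apply)
  · have hj1 : 1 ≤ j := (le_max_right a 1).trans hja
    obtain ⟨h1, h2⟩ :=
      revBits_restrict π (padIndex j) j hj1 (fun k _ => padIndex_strictMono.lt_iff_lt)
    have hj0 : (0 : ℝ) < j := by exact_mod_cast hj1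
    have h3 : (1 / 6 : ℝ) ≤ revRatio (π.restrict (padIndex j)).reverse := by
      refine le_trans ?_ h2
      rw [div_le_div_iff₀ (by positivity) (by positivity)]
      nlinarith
    rw [liftMartingale, h1]
    have h4 := mul_le_mul_of_nonneg_left h3 (hd.1 (charPrefix (Lpi π) j))
    have h5 := le_abs_self C
    linarith
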